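/- arXiv:1908.09594 — 2 statements merged into one kernel-verified Lean document; each statement's English description precedes it below -/
import Mathlib

section
/- The one-step polar transform boosts the symmetric cutoff rate: for every binary-input memoryless channel W with finite output alphabet, R₀(W⁻) + R₀(W⁺) ≥ 2·R₀(W), with strict inequality whenever 0 < Z(W) < 1. -/
open scoped BigOperators

/-- Bhattacharyya parameter of a BMC. -/
noncomputable def bhattacharyya {Y : Type*} [Fintype Y] (W : ZMod 2 → Y → ℝ) : ℝ :=
  ∑ y : Y, Real.sqrt (W 0 y * W 1 y)

/-- Symmetric cutoff rate of a BMC: `R₀(W) = 1 − log₂(1 + Z(W))`. -/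
noncomputable def cutoffRate {Y : Type*} [Fintype Y] (W : ZMod 2 → Y → ℝ) : ℝ :=
  1 - Real.logb 2 (1 + bhattacharyya W)

/-- The minus channel `W⁻` of the one-step polar transform:
`W⁻ u₁ (y₁, y₂) = ∑_{u₂} (1/2)·W (u₁+u₂) y₁ · W u₂ y₂`. -/
noncomputable def Wminus {Y : Type*} (W : ZMod 2 → Y → ℝ) : ZMod 2 → Y × Y → ℝ :=
  fun u₁ y => ∑ u₂ : ZMod 2, (1 / 2) * W (u₁ + u₂) y.1 * W u₂ y.2

/-- The plus channel `W⁺` of the one-step polar transform: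
`W⁺ u₂ (y₁, y₂, u₁) = (1/2)·W (u₁+u₂) y₁ · W u₂ y₂`. -/
noncomputable def Wplus {Y : Type*} (W : ZMod 2 → Y → ℝ) : ZMod 2 → Y × Y × ZMod 2 → ℝ :=
  fun u₂ y => (1 / 2) * W (y.2.2 + u₂) y.1 * W u₂ y.2.1

theorem bhattacharyya_nonneg {Y : Type*} [Fintype Y] (W : ZMod 2 → Y → ℝ) :
    0 ≤ bhattacharyya W :=
  Finset.sum_nonneg fun _ _ => Real.sqrt_nonneg _

theorem bhattacharyya_Wplus {Y : Type*} [Fintype Y] (W : ZMod 2 → Y → ℝ)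
    (hW : ∀ x y, 0 ≤ W x y) : bhattacharyya (Wplus W) = bhattacharyya W ^ 2 := by
  have hterm : ∀ (y₁ y₂ : Y) (u : ZMod 2),
      Real.sqrt (Wplus W 0 (y₁, y₂, u) * Wplus W 1 (y₁, y₂, u)) =
        (1 / 2) * (Real.sqrt (W 0 y₁ * W 1 y₁) * Real.sqrt (W 0 y₂ * W 1 y₂)) := by
    intro y₁ y₂ u
    have h : Wplus W 0 (y₁, y₂, u) * Wplus W 1 (y₁, y₂, u) =
        (1 / 2) ^ 2 * ((W 0 y₁ * W 1 y₁) * (W 0 y₂ * W 1 y₂)) := by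
      have hu : W u y₁ * W (u + 1) y₁ = W 0 y₁ * W 1 y₁ := by
        fin_cases u
        · rfl
        · exact mul_comm _ _
      simp only [Wplus, add_zero]
      linear_combination (1 / 4) * W 0 y₂ * W 1 y₂ * hu
    rw [h, Real.sqrt_mul (by positivity), Real.sqrt_sq (by norm_num),
      Real.sqrt_mul (mul_nonneg (hW _ _) (hW _ _))]
  simp only [bhattacharyya, Fintype.sum_prod_type, hterm, sq, Finset.sum_mul_sum]
  refine Finset.sum_congr rfl fun y₁ _ => Finset.sum_congr rfl fun y₂ _ => ?_
  rw [Finset.sum_const, Finset.card_univ, ZMod.card, nsmul_eq_mul]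
  push_cast
  ring

theorem sqrt_mul_convolution_le {a b c d : ℝ} (ha : 0 ≤ a) (hb : 0 ≤ b) (hc : 0 ≤ c)
    (hd : 0 ≤ d) :
    Real.sqrt ((a * c + b * d) * (b * c + a * d)) ≤
      Real.sqrt (c * d) * (a + b) + Real.sqrt (a * b) * (c + d)
        - 2 * (Real.sqrt (a * b) * Real.sqrt (c * d)) := by
  have two_sqrt_le : ∀ {x y : ℝ}, 0 ≤ x → 0 ≤ y → 2 * Real.sqrt (x * y) ≤ x + y := by
    intro x y hx hy
    rw [Real.sqrt_mul hx]
    nlinarith [sq_nonneg (Real.sqrt x - Real.sqrt y), Real.sq_sqrt hx, Real.sq_sqrt hy]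
  have hs := two_sqrt_le ha hb
  have ht := two_sqrt_le hc hd
  have hp := Real.sqrt_nonneg (a * b)
  have hq := Real.sqrt_nonneg (c * d)
  have hp2 := Real.sq_sqrt (mul_nonneg ha hb)
  have hq2 := Real.sq_sqrt (mul_nonneg hc hd)
  set p := Real.sqrt (a * b)
  set q := Real.sqrt (c * d)
  apply Real.sqrt_le_iff.mpr
  constructor
  · nlinarith [mul_nonneg hq (sub_nonneg.mpr hs), mul_nonneg hp (add_nonneg hc hd)]
  · have key : (a * c + b * d) * (b * c + a * d) =
        q ^ 2 * (a + b) ^ 2 + p ^ 2 * (c + d) ^ 2 - 4 * p ^ 2 * q ^ 2 := by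
      rw [hp2, hq2]
      ring
    have h := mul_nonneg (mul_nonneg hp hq) (mul_nonneg (sub_nonneg.mpr hs) (sub_nonneg.mpr ht))
    rw [key]
    linear_combination 2 * h

theorem bhattacharyya_Wminus_le {Y : Type*} [Fintype Y] (W : ZMod 2 → Y → ℝ)
    (hW0 : ∀ x y, 0 ≤ W x y) (hW1 : ∀ x, ∑ y : Y, W x y = 1) :
    bhattacharyya (Wminus W) ≤ 2 * bhattacharyya W - bhattacharyya W ^ 2 := by
  set p : Y → ℝ := fun y => Real.sqrt (W 0 y * W 1 y) with hp
  set s : Y → ℝ := fun y => W 0 y + W 1 y with hs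
  have hsum_s : ∑ y, s y = 2 := by
    simp only [hs, Finset.sum_add_distrib, hW1]
    norm_num
  have hterm : ∀ y₁ y₂ : Y,
      Real.sqrt (Wminus W 0 (y₁, y₂) * Wminus W 1 (y₁, y₂)) ≤
        (1 / 2) * (s y₁ * p y₂ + p y₁ * s y₂ - 2 * (p y₁ * p y₂)) := by
    intro y₁ y₂
    have h0 : Wminus W 0 (y₁, y₂) = 1 / 2 * (W 0 y₁ * W 0 y₂ + W 1 y₁ * W 1 y₂) := by
      change ∑ u : Fin 2, _ = _
      rw [Fin.sum_univ_two]
      change 1 / 2 * W 0 y₁ * W 0 y₂ + 1 / 2 * W 1 y₁ * W 1 y₂ = _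
      ring
    have h1 : Wminus W 1 (y₁, y₂) = 1 / 2 * (W 1 y₁ * W 0 y₂ + W 0 y₁ * W 1 y₂) := by
      change ∑ u : Fin 2, _ = _
      rw [Fin.sum_univ_two]
      change 1 / 2 * W 1 y₁ * W 0 y₂ + 1 / 2 * W 0 y₁ * W 1 y₂ = _
      ring
    rw [h0, h1, mul_mul_mul_comm, ← sq, Real.sqrt_mul (by positivity),
      Real.sqrt_sq (by norm_num)]
    have h := sqrt_mul_convolution_le (hW0 0 y₁) (hW0 1 y₁) (hW0 0 y₂) (hW0 1 y₂)
    simp only [hp, hs]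
    linarith
  calc bhattacharyya (Wminus W)
      ≤ ∑ y₁, ∑ y₂, (1 / 2) * (s y₁ * p y₂ + p y₁ * s y₂ - 2 * (p y₁ * p y₂)) := by
        rw [bhattacharyya, Fintype.sum_prod_type]
        exact Finset.sum_le_sum fun y₁ _ => Finset.sum_le_sum fun y₂ _ => hterm y₁ y₂
    _ = (1 / 2) * ((∑ y, s y) * (∑ y, p y) + (∑ y, p y) * (∑ y, s y)
          - 2 * ((∑ y, p y) * (∑ y, p y))) := by
        simp only [← Finset.mul_sum, Finset.sum_sub_distrib, Finset.sum_add_distrib,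
          Finset.sum_mul]
    _ = 2 * bhattacharyya W - bhattacharyya W ^ 2 := by
        rw [hsum_s, show ∑ y, p y = bhattacharyya W from rfl]
        ring

theorem cutoffRate_add_cutoffRate {X Y : Type*} [Fintype X] [Fintype Y] (V : ZMod 2 → X → ℝ)
    (W : ZMod 2 → Y → ℝ) :
    cutoffRate V + cutoffRate W =
      2 - Real.logb 2 ((1 + bhattacharyya V) * (1 + bhattacharyya W)) := by
  have hV := bhattacharyya_nonneg V
  have hW := bhattacharyya_nonneg W
  rw [Real.logb_mul (by positivity) (by positivity), cutoffRate, cutoffRate]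
  ring

theorem stmt10 {Y : Type*} [Fintype Y] [Nonempty Y] (W : ZMod 2 → Y → ℝ)
    (hW0 : ∀ x y, 0 ≤ W x y) (hW1 : ∀ x, ∑ y : Y, W x y = 1) :
    2 * cutoffRate W ≤ cutoffRate (Wminus W) + cutoffRate (Wplus W) ∧
    (0 < bhattacharyya W → bhattacharyya W < 1 →
      2 * cutoffRate W < cutoffRate (Wminus W) + cutoffRate (Wplus W)) := by
  have hZ := bhattacharyya_nonneg W
  have hM := bhattacharyya_nonneg (Wminus W)
  have hle : (1 + bhattacharyya (Wminus W)) * (1 + bhattacharyya W ^ 2) ≤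
      (1 + bhattacharyya W) * (1 + bhattacharyya W)
        - (bhattacharyya W * (1 - bhattacharyya W)) ^ 2 := by
    have h := mul_le_mul_of_nonneg_right (bhattacharyya_Wminus_le W hW0 hW1)
      (by positivity : 0 ≤ 1 + bhattacharyya W ^ 2)
    linear_combination h
  rw [two_mul, cutoffRate_add_cutoffRate, cutoffRate_add_cutoffRate, bhattacharyya_Wplus W hW0]
  refine ⟨sub_le_sub_left (Real.logb_le_logb_of_le one_lt_two (by positivity) ?_) 2,
    fun h0 h1 => sub_lt_sub_left (Real.logb_lt_logb one_lt_two (by positivity) ?_) 2⟩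
  · exact hle.trans (sub_le_self _ (sq_nonneg _))
  · exact hle.trans_lt (sub_lt_self _ (pow_pos (mul_pos h0 (sub_pos.mpr h1)) 2))
end

section
/- Capacity conservation for multi-level coding with multi-stage decoding: let W : ZMod 2 → Y → ℝ be a BMC with finite output alphabet Y, let N ≥ 1, and let P : (Fin N → ZMod 2) → (Fin N → ZMod 2) be any bijection (the mapper). For each i ∈ Fin N define the i-th bit-channel Wᵢ with input alphabet ZMod 2 and output alphabet (Fin N → Y) × ({j : Fin N // j < i} → ZMod 2) by Wᵢ uᵢ (y, v) = ∑ over all u ∈ (Fin N → ZMod 2) with u i = uᵢ and u j = v j for all j < i, of 2^{−(N−1)} · ∏_{k} W ((P u) k) (y k). Then each Wᵢ is a BMC and ∑_{i=1}^{N} C(Wᵢ) = N · C(W). -/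
open scoped BigOperators

/-- Symmetric capacity of a binary-input memoryless channel with finite output
alphabet `Y`.  Terms with `W x y = 0` automatically contribute `0`. -/
noncomputable def capacity {Y : Type*} [Fintype Y] (W : ZMod 2 → Y → ℝ) : ℝ :=
  ∑ y : Y, ∑ x : ZMod 2,
    (1 / 2) * W x y * Real.logb 2 (W x y / ((1 / 2) * W 0 y + (1 / 2) * W 1 y))

/-- The idealized `i`-th bit-channel of the MLC/MSD scheme with mapper `P`:
its input is the bit `uᵢ`, its output is the whole channel output word
together with the (correct) previous input bits, and its transition
probabilities average uniformly over the remaining input bits. -/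
noncomputable def bitChannel {Y : Type*} [Fintype Y] (W : ZMod 2 → Y → ℝ) (N : ℕ)
    (P : (Fin N → ZMod 2) → (Fin N → ZMod 2)) (i : Fin N) :
    ZMod 2 → (Fin N → Y) × ({j : Fin N // j < i} → ZMod 2) → ℝ :=
  fun ui yv =>
    ∑ u ∈ Finset.univ.filter
        (fun u : Fin N → ZMod 2 =>
          u i = ui ∧ ∀ j : {j : Fin N // j < i}, u j.1 = yv.2 j),
      (1 / 2 : ℝ) ^ (N - 1) * ∏ k : Fin N, W (P u k) (yv.1 k)

/-- Unnormalised likelihood of the output word `y` given the first `m` bits of `u`. -/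
noncomputable def partialLikelihood {Y : Type*} (W : ZMod 2 → Y → ℝ) {N : ℕ}
    (P : (Fin N → ZMod 2) → (Fin N → ZMod 2)) (y : Fin N → Y) (u : Fin N → ZMod 2) (m : ℕ) : ℝ :=
  ∑ w ∈ Finset.univ.filter (fun w : Fin N → ZMod 2 => ∀ j : Fin N, (j : ℕ) < m → w j = u j),
    ∏ k, W (P w k) (y k)

lemma partialLikelihood_pos {Y : Type*} {W : ZMod 2 → Y → ℝ} (hW0 : ∀ x y, 0 ≤ W x y) {N : ℕ}
    {P : (Fin N → ZMod 2) → (Fin N → ZMod 2)} {y : Fin N → Y} {u : Fin N → ZMod 2}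
    (h : ∏ k, W (P u k) (y k) ≠ 0) (m : ℕ) : 0 < partialLikelihood W P y u m := by
  unfold partialLikelihood
  refine Finset.sum_pos' (fun w _ => Finset.prod_nonneg fun k _ => hW0 _ _) ⟨u, by simp, ?_⟩
  exact lt_of_le_of_ne (Finset.prod_nonneg fun k _ => hW0 _ _) h.symm

lemma partialLikelihood_full {Y : Type*} (W : ZMod 2 → Y → ℝ) {N : ℕ}
    (P : (Fin N → ZMod 2) → (Fin N → ZMod 2)) (y : Fin N → Y) (u : Fin N → ZMod 2) :
    partialLikelihood W P y u N = ∏ k, W (P u k) (y k) := by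
  have : Finset.univ.filter (fun w : Fin N → ZMod 2 => ∀ j : Fin N, (j : ℕ) < N → w j = u j)
      = {u} := by
    ext w
    simp [funext_iff]
  rw [partialLikelihood, this, Finset.sum_singleton]

lemma sum_zmod_two {M : Type*} [AddCommMonoid M] (f : ZMod 2 → M) : ∑ x, f x = f 0 + f 1 :=
  Fin.sum_univ_two f

lemma partialLikelihood_zero {Y : Type*} (W : ZMod 2 → Y → ℝ) {N : ℕ}
    {P : (Fin N → ZMod 2) → (Fin N → ZMod 2)} (hP : Function.Bijective P)
    (y : Fin N → Y) (u : Fin N → ZMod 2) :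
    partialLikelihood W P y u 0 = ∏ k, (W 0 (y k) + W 1 (y k)) := by
  have h1 : partialLikelihood W P y u 0 = ∑ w : Fin N → ZMod 2, ∏ k, W (P w k) (y k) := by
    simp [partialLikelihood]
  rw [h1, hP.sum_comp (fun w : Fin N → ZMod 2 => ∏ k, W (w k) (y k))]
  have h2 : ∀ k, W 0 (y k) + W 1 (y k) = ∑ x, W x (y k) := fun k =>
    (sum_zmod_two fun x => W x (y k)).symm
  rw [Finset.prod_congr rfl fun k _ => h2 k, Finset.prod_univ_sum, Fintype.piFinset_univ]

lemma bitChannel_eq_partialLikelihood {Y : Type*} [Fintype Y] (W : ZMod 2 → Y → ℝ) {N : ℕ}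
    (P : (Fin N → ZMod 2) → (Fin N → ZMod 2)) (i : Fin N) (y : Fin N → Y) (u : Fin N → ZMod 2) :
    bitChannel W N P i (u i) (y, fun j => u j.1)
      = (1 / 2 : ℝ) ^ (N - 1) * partialLikelihood W P y u (i + 1) := by
  rw [bitChannel, partialLikelihood, ← Finset.mul_sum]
  congr 2
  ext w
  simp only [Finset.mem_filter, Finset.mem_univ, true_and, Subtype.forall]
  constructor
  · rintro ⟨h1, h2⟩ j hj
    rcases (Nat.lt_succ_iff_lt_or_eq.1 hj) with h | h
    · exact h2 j h
    · rw [Fin.ext h, h1]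
  · exact fun h => ⟨h i (Nat.lt_succ_self _), fun j hj => h j (Nat.lt_succ_of_lt hj)⟩

lemma bitChannel_add_bitChannel {Y : Type*} [Fintype Y] (W : ZMod 2 → Y → ℝ) {N : ℕ}
    (P : (Fin N → ZMod 2) → (Fin N → ZMod 2)) (i : Fin N) (y : Fin N → Y) (u : Fin N → ZMod 2) :
    bitChannel W N P i 0 (y, fun j => u j.1) + bitChannel W N P i 1 (y, fun j => u j.1)
      = (1 / 2 : ℝ) ^ (N - 1) * partialLikelihood W P y u i := by
  rw [← sum_zmod_two (fun x => bitChannel W N P i x (y, fun j => u j.1)), partialLikelihood,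
    Finset.mul_sum, ← Finset.sum_fiberwise _ (fun w : Fin N → ZMod 2 => w i)]
  refine Finset.sum_congr rfl fun x _ => ?_
  rw [bitChannel, Finset.filter_filter]
  refine Finset.sum_congr ?_ fun _ _ => rfl
  ext w
  simp only [Finset.mem_filter, Finset.mem_univ, true_and, Subtype.forall, Fin.lt_def]
  exact and_comm

lemma sum_bitChannel_mul {Y : Type*} [Fintype Y] (W : ZMod 2 → Y → ℝ) {N : ℕ}
    (P : (Fin N → ZMod 2) → (Fin N → ZMod 2)) (i : Fin N)
    (F : ZMod 2 → (Fin N → Y) × ({j : Fin N // j < i} → ZMod 2) → ℝ) :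
    ∑ yv, ∑ x, bitChannel W N P i x yv * F x yv
      = (1 / 2 : ℝ) ^ (N - 1) * ∑ y : Fin N → Y, ∑ u : Fin N → ZMod 2,
          (∏ k, W (P u k) (y k)) * F (u i) (y, fun j => u j.1) := by
  rw [Fintype.sum_prod_type, Finset.mul_sum]
  refine Finset.sum_congr rfl fun y _ => ?_
  rw [Finset.mul_sum, ← Finset.sum_fiberwise _
    (fun u : Fin N → ZMod 2 => ((fun j => u j.1 : {j : Fin N // j < i} → ZMod 2), u i)),
    Fintype.sum_prod_type]
  refine Finset.sum_congr rfl fun v _ => Finset.sum_congr rfl fun x _ => ?_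
  rw [bitChannel, Finset.sum_mul]
  refine Finset.sum_congr ?_ ?_
  · ext w
    simp only [Finset.mem_filter, Finset.mem_univ, true_and, Prod.mk.injEq, funext_iff]
    exact and_comm
  · intro w hw
    have h := (Finset.mem_filter.1 hw).2
    rw [mul_assoc, (Prod.mk.inj h).1, (Prod.mk.inj h).2]

lemma bitChannel_nonneg {Y : Type*} [Fintype Y] {W : ZMod 2 → Y → ℝ} (hW0 : ∀ x y, 0 ≤ W x y)
    {N : ℕ} (P : (Fin N → ZMod 2) → (Fin N → ZMod 2)) (i : Fin N) (x : ZMod 2)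
    (yv : (Fin N → Y) × ({j : Fin N // j < i} → ZMod 2)) : 0 ≤ bitChannel W N P i x yv :=
  Finset.sum_nonneg fun _ _ => mul_nonneg (by positivity) (Finset.prod_nonneg fun _ _ => hW0 _ _)

lemma sum_prod_channel {Y : Type*} [Fintype Y] {W : ZMod 2 → Y → ℝ}
    (hW1 : ∀ x, ∑ y : Y, W x y = 1) {N : ℕ} (x : Fin N → ZMod 2) :
    ∑ y : Fin N → Y, ∏ k, W (x k) (y k) = 1 := by
  have h := Finset.prod_univ_sum (fun _ : Fin N => (Finset.univ : Finset Y)) fun k y => W (x k) y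
  rw [Fintype.piFinset_univ] at h
  simp [← h, hW1]

lemma card_filter_apply_eq {N : ℕ} (i : Fin N) (x : ZMod 2) :
    (Finset.univ.filter fun u : Fin N → ZMod 2 => u i = x).card = 2 ^ (N - 1) := by
  have h := Fintype.card_filter_piFinset_eq_of_mem
    (fun _ : Fin N => (Finset.univ : Finset (ZMod 2))) i (Finset.mem_univ x)
  rw [Fintype.piFinset_univ] at h
  rw [h]
  simp [ZMod.card]

lemma sum_bitChannel {Y : Type*} [Fintype Y] {W : ZMod 2 → Y → ℝ}
    (hW1 : ∀ x, ∑ y : Y, W x y = 1) {N : ℕ} (P : (Fin N → ZMod 2) → (Fin N → ZMod 2))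
    (i : Fin N) (x : ZMod 2) : ∑ yv, bitChannel W N P i x yv = 1 := by
  have h := sum_bitChannel_mul W P i (fun x' _ => if x' = x then 1 else 0)
  simp only [mul_ite, mul_one, mul_zero, Finset.sum_ite_eq', Finset.mem_univ, if_true] at h
  rw [h, Finset.sum_comm]
  have h2 : ∀ u : Fin N → ZMod 2,
      (∑ y : Fin N → Y, if u i = x then ∏ k, W (P u k) (y k) else 0)
        = if u i = x then 1 else 0 := by
    intro u
    split_ifs
    · exact sum_prod_channel hW1 _
    · simp
  simp_rw [h2]
  rw [Finset.sum_boole, card_filter_apply_eq]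
  push_cast
  rw [← mul_pow]
  norm_num

/-- The marginal of one coordinate under a product weight of total mass one. -/
lemma sum_prod_mul_apply {Z : Type*} [Fintype Z] (p φ : Z → ℝ) (hp : ∑ z, p z = 1) {N : ℕ}
    (k : Fin N) : ∑ z : Fin N → Z, (∏ j, p (z j)) * φ (z k) = ∑ z, p z * φ z := by
  have h := Finset.prod_univ_sum (fun _ : Fin N => (Finset.univ : Finset Z))
    fun j z => p z * if j = k then φ z else 1
  rw [Fintype.piFinset_univ] at h
  have h1 : ∀ z : Fin N → Z, ∏ j, (p (z j) * if j = k then φ (z j) else 1)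
      = (∏ j, p (z j)) * φ (z k) := by
    intro z
    rw [Finset.prod_mul_distrib]
    simp
  simp_rw [h1] at h
  rw [← h, Finset.prod_eq_single k]
  · simp
  · intro j _ hj
    simp [hj, hp]
  · simp

lemma sum_channel_word_mul {Y : Type*} [Fintype Y] {W : ZMod 2 → Y → ℝ}
    (hW1 : ∀ x, ∑ y : Y, W x y = 1) (φ : ZMod 2 → Y → ℝ) {N : ℕ} (k : Fin N) :
    (1 / 2 : ℝ) ^ N * ∑ y : Fin N → Y, ∑ x : Fin N → ZMod 2,
        (∏ j, W (x j) (y j)) * φ (x k) (y k)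
      = ∑ y, ∑ x, 1 / 2 * W x y * φ x y := by
  have hp : ∑ z : Y × ZMod 2, 1 / 2 * W z.2 z.1 = 1 := by
    rw [Fintype.sum_prod_type, Finset.sum_comm]
    simp_rw [← Finset.mul_sum, hW1]
    simp [ZMod.card]
  have h := sum_prod_mul_apply (fun z : Y × ZMod 2 => 1 / 2 * W z.2 z.1)
    (fun z => φ z.2 z.1) hp k
  rw [Fintype.sum_prod_type] at h
  rw [← h, ← (Equiv.arrowProdEquivProdArrow (Fin N) (fun _ => Y) (fun _ => ZMod 2)).symm.sum_comp,
    Fintype.sum_prod_type, Finset.mul_sum]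
  refine Finset.sum_congr rfl fun y _ => ?_
  rw [Finset.mul_sum]
  refine Finset.sum_congr rfl fun x _ => ?_
  simp [Equiv.arrowProdEquivProdArrow, Finset.prod_mul_distrib, mul_assoc]

lemma capacity_bitChannel {Y : Type*} [Fintype Y] {W : ZMod 2 → Y → ℝ}
    (hW0 : ∀ x y, 0 ≤ W x y) {N : ℕ} (P : (Fin N → ZMod 2) → (Fin N → ZMod 2)) (i : Fin N) :
    capacity (bitChannel W N P i)
      = (1 / 2 : ℝ) ^ N * ∑ y : Fin N → Y, ∑ u : Fin N → ZMod 2, (∏ k, W (P u k) (y k)) *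
          (1 + (Real.logb 2 (partialLikelihood W P y u (i + 1))
            - Real.logb 2 (partialLikelihood W P y u i))) := by
  have hN : (1 / 2 : ℝ) ^ N = (1 / 2) ^ (N - 1) * (1 / 2) := by
    rw [← pow_succ, Nat.sub_add_cancel i.pos]
  have h := sum_bitChannel_mul W P i fun x yv => 1 / 2 * Real.logb 2 (bitChannel W N P i x yv /
    ((1 / 2) * bitChannel W N P i 0 yv + (1 / 2) * bitChannel W N P i 1 yv))
  have hc : capacity (bitChannel W N P i) = ∑ yv, ∑ x, bitChannel W N P i x yv *
      (1 / 2 * Real.logb 2 (bitChannel W N P i x yv /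
        ((1 / 2) * bitChannel W N P i 0 yv + (1 / 2) * bitChannel W N P i 1 yv))) := by
    refine Finset.sum_congr rfl fun yv _ => Finset.sum_congr rfl fun x _ => ?_
    ring
  rw [hc, h, hN, mul_assoc]
  congr 1
  rw [Finset.mul_sum]
  refine Finset.sum_congr rfl fun y _ => ?_
  rw [Finset.mul_sum]
  refine Finset.sum_congr rfl fun u _ => ?_
  by_cases h0 : ∏ k, W (P u k) (y k) = 0
  · simp [h0]
  have hA := partialLikelihood_pos hW0 h0 (i + 1)
  have hB := partialLikelihood_pos hW0 h0 i
  have hr : bitChannel W N P i (u i) (y, fun j => u j.1) /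
      (1 / 2 * bitChannel W N P i 0 (y, fun j => u j.1)
        + 1 / 2 * bitChannel W N P i 1 (y, fun j => u j.1))
      = 2 * (partialLikelihood W P y u (i + 1) / partialLikelihood W P y u i) := by
    rw [← mul_add, bitChannel_add_bitChannel, bitChannel_eq_partialLikelihood]
    field_simp
  rw [hr, Real.logb_mul two_ne_zero (div_pos hA hB).ne', Real.logb_div hA.ne' hB.ne',
    Real.logb_self_eq_one one_lt_two]
  ring

lemma sum_logb_partialLikelihood {Y : Type*} {W : ZMod 2 → Y → ℝ} (hW0 : ∀ x y, 0 ≤ W x y)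
    {N : ℕ} {P : (Fin N → ZMod 2) → (Fin N → ZMod 2)} (hP : Function.Bijective P)
    {y : Fin N → Y} {u : Fin N → ZMod 2} (h : ∏ k, W (P u k) (y k) ≠ 0) :
    ∑ i : Fin N, (1 + (Real.logb 2 (partialLikelihood W P y u (i + 1))
        - Real.logb 2 (partialLikelihood W P y u i)))
      = ∑ k, Real.logb 2 (W (P u k) (y k) / ((1 / 2) * W 0 (y k) + (1 / 2) * W 1 (y k))) := by
  have hne : ∀ k, W (P u k) (y k) ≠ 0 := fun k => Finset.prod_ne_zero_iff.1 h k (Finset.mem_univ k)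
  have hq : ∀ k, W 0 (y k) + W 1 (y k) ≠ 0 := by
    have h0 := (partialLikelihood_pos hW0 h 0).ne'
    rw [partialLikelihood_zero W hP] at h0
    exact fun k => Finset.prod_ne_zero_iff.1 h0 k (Finset.mem_univ k)
  rw [Finset.sum_add_distrib, Fin.sum_univ_eq_sum_range (fun m =>
    Real.logb 2 (partialLikelihood W P y u (m + 1)) - Real.logb 2 (partialLikelihood W P y u m)),
    Finset.sum_range_sub (fun m => Real.logb 2 (partialLikelihood W P y u m)),
    partialLikelihood_full, partialLikelihood_zero W hP, Real.logb_prod _ _ fun k _ => hne k,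
    Real.logb_prod _ _ fun k _ => hq k, ← Finset.sum_sub_distrib, ← Finset.sum_add_distrib]
  refine Finset.sum_congr rfl fun k _ => ?_
  have hr : W (P u k) (y k) / (1 / 2 * W 0 (y k) + 1 / 2 * W 1 (y k))
      = 2 * (W (P u k) (y k) / (W 0 (y k) + W 1 (y k))) := by
    have := hq k
    rw [← mul_add]
    field_simp
  rw [hr, Real.logb_mul two_ne_zero (div_ne_zero (hne k) (hq k)), Real.logb_div (hne k) (hq k),
    Real.logb_self_eq_one one_lt_two]

theorem stmt16 {Y : Type*} [Fintype Y] [Nonempty Y] (W : ZMod 2 → Y → ℝ)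
    (hW0 : ∀ x y, 0 ≤ W x y) (hW1 : ∀ x, ∑ y : Y, W x y = 1)
    (N : ℕ) (hN : 1 ≤ N) (P : (Fin N → ZMod 2) → (Fin N → ZMod 2))
    (hP : Function.Bijective P) :
    (∀ i : Fin N,
      (∀ x yv, 0 ≤ bitChannel W N P i x yv) ∧
      (∀ x, ∑ yv, bitChannel W N P i x yv = 1)) ∧
    ∑ i : Fin N, capacity (bitChannel W N P i) = N * capacity W := by
  refine ⟨fun i => ⟨bitChannel_nonneg hW0 P i, sum_bitChannel hW1 P i⟩, ?_⟩
  have hC : ∀ k : Fin N, capacity W = (1 / 2 : ℝ) ^ N * ∑ y : Fin N → Y, ∑ u : Fin N → ZMod 2,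
      (∏ j, W (P u j) (y j)) *
        Real.logb 2 (W (P u k) (y k) / ((1 / 2) * W 0 (y k) + (1 / 2) * W 1 (y k))) := by
    intro k
    rw [capacity, ← sum_channel_word_mul hW1
      (fun x y => Real.logb 2 (W x y / ((1 / 2) * W 0 y + (1 / 2) * W 1 y))) k]
    congr 1
    refine Finset.sum_congr rfl fun y _ => ?_
    exact (hP.sum_comp (fun x : Fin N → ZMod 2 => (∏ j, W (x j) (y j)) *
      Real.logb 2 (W (x k) (y k) / ((1 / 2) * W 0 (y k) + (1 / 2) * W 1 (y k))))).symm
  have hNC : (N : ℝ) * capacity W = ∑ _k : Fin N, capacity W := by simp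
  rw [hNC, Finset.sum_congr rfl fun k _ => hC k,
    Finset.sum_congr rfl fun i _ => capacity_bitChannel hW0 P i, ← Finset.mul_sum,
    ← Finset.mul_sum, Finset.sum_comm, Finset.sum_comm (s := Finset.univ (α := Fin N))]
  congr 1
  refine Finset.sum_congr rfl fun y _ => ?_
  rw [Finset.sum_comm, Finset.sum_comm (s := Finset.univ (α := Fin N))]
  refine Finset.sum_congr rfl fun u _ => ?_
  rw [← Finset.mul_sum, ← Finset.mul_sum]
  by_cases h0 : ∏ k, W (P u k) (y k) = 0
  · simp [h0]
  · rw [sum_logb_partialLikelihood hW0 hP h0]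
end
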